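/- arXiv:1901.08218 — 2 statements merged into one kernel-verified Lean document; each statement's English description precedes it below -/
import Mathlib

section
/- Let Ū : (−1,1) → ℝ be continuous and suppose there exist constants u₊ ∈ ℝ, α ∈ (0,1] and C₀ > 0 such that |Ū(x) − 2 − 4/ln((1+x)/3)| ≤ C₀(ln((1+x)/3))^{−2} for all x ∈ (−1,0] and |Ū(x) − u₊| ≤ C₀(1−x)^α for all x ∈ [0,1). Then there exists a constant C > 0 such that for all x ∈ (−1,1): e^{b(x)} ≤ C(ln((1+x)/3))²(1+x)(1−x)^{−u₊/2}, e^{−b(x)} ≤ C(ln((1+x)/3))^{−2}(1+x)^{−1}(1−x)^{u₊/2}, e^{a(x)} ≤ C(ln((1+x)/3))²(1−x)^{−1−u₊/2}, and e^{−a(x)} ≤ C(ln((1+x)/3))^{−2}(1−x)^{1+u₊/2}. -/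
open Set Filter

/-- `a(x) = ∫₀ˣ (2s + Ū(s))/(1−s²) ds`. -/
noncomputable def aF (U : ℝ → ℝ) (x : ℝ) : ℝ := ∫ s in (0:ℝ)..x, (2*s + U s) / (1 - s^2)

/-- `b(x) = ∫₀ˣ Ū(s)/(1−s²) ds`. -/
noncomputable def bF (U : ℝ → ℝ) (x : ℝ) : ℝ := ∫ s in (0:ℝ)..x, U s / (1 - s^2)

/-- On `(-1, 1)` the function `log ((1 + x) / 3)` stays below `-1/3`. -/
lemma log_add_div_three_lt {x : ℝ} (hx : x ∈ Ioo (-1 : ℝ) 1) :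
    Real.log ((1 + x) / 3) < -(1 / 3) := by
  obtain ⟨h1, h2⟩ := hx
  have := Real.log_le_sub_one_of_pos (x := (1 + x) / 3) (by linarith)
  linarith

lemma hasDerivAt_log_add_div_three {x : ℝ} (hx : -1 < x) :
    HasDerivAt (fun y : ℝ => Real.log ((1 + y) / 3)) (1 / (1 + x)) x := by
  have h0 : (1 + x) / 3 ≠ 0 := by
    have : 0 < (1 + x) / 3 := by linarith
    exact this.ne'
  have h := (((hasDerivAt_id x).const_add 1).div_const 3).log h0
  refine h.congr_deriv ?_
  have : 1 + x ≠ 0 := by linarith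
  simp only [id]
  field_simp

lemma uIcc_zero_subset_Ioo {x : ℝ} (hx : x ∈ Ioo (-1 : ℝ) 1) :
    uIcc 0 x ⊆ Ioo (-1 : ℝ) 1 :=
  ordConnected_Ioo.uIcc_subset (by norm_num) hx

lemma one_sub_sq_pos {x : ℝ} (hx : x ∈ Ioo (-1 : ℝ) 1) : 0 < 1 - x ^ 2 := by
  obtain ⟨h1, h2⟩ := hx
  nlinarith

lemma continuousOn_div_one_sub_sq {f : ℝ → ℝ} (hf : ContinuousOn f (Ioo (-1 : ℝ) 1)) :
    ContinuousOn (fun s => f s / (1 - s ^ 2)) (Ioo (-1 : ℝ) 1) :=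
  hf.div (by fun_prop) fun _ hx => (one_sub_sq_pos hx).ne'

lemma hasDerivAt_bF {U : ℝ → ℝ} (hU : ContinuousOn U (Ioo (-1 : ℝ) 1)) {x : ℝ}
    (hx : x ∈ Ioo (-1 : ℝ) 1) : HasDerivAt (bF U) (U x / (1 - x ^ 2)) x := by
  have hc := continuousOn_div_one_sub_sq hU
  refine intervalIntegral.integral_hasDerivAt_right
    (hc.mono (uIcc_zero_subset_Ioo hx)).intervalIntegrable
    (hc.stronglyMeasurableAtFilter isOpen_Ioo x hx) (hc.continuousAt (isOpen_Ioo.mem_nhds hx))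

lemma aF_eq_bF_sub_log {U : ℝ → ℝ} (hU : ContinuousOn U (Ioo (-1 : ℝ) 1)) {x : ℝ}
    (hx : x ∈ Ioo (-1 : ℝ) 1) : aF U x = bF U x - Real.log (1 - x ^ 2) := by
  have hsub := uIcc_zero_subset_Ioo hx
  have h2 : ContinuousOn (fun s : ℝ => 2 * s / (1 - s ^ 2)) (Ioo (-1 : ℝ) 1) :=
    continuousOn_div_one_sub_sq (by fun_prop)
  have hint : ∫ s in (0 : ℝ)..x, 2 * s / (1 - s ^ 2) = -Real.log (1 - x ^ 2) := by
    rw [intervalIntegral.integral_eq_sub_of_hasDerivAt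
      (f := fun s : ℝ => -Real.log (1 - s ^ 2)) _ (h2.mono hsub).intervalIntegrable]
    · simp
    · intro s hs
      have h := ((((hasDerivAt_id s).pow 2).const_sub 1).log
        (one_sub_sq_pos (hsub hs)).ne').neg
      refine h.congr_deriv ?_
      simp [neg_div]
  have hadd : aF U x = (∫ s in (0 : ℝ)..x, 2 * s / (1 - s ^ 2)) + bF U x := by
    rw [aF, bF, ← intervalIntegral.integral_add (h2.mono hsub).intervalIntegrable
      ((continuousOn_div_one_sub_sq hU).mono hsub).intervalIntegrable]
    simp only [add_div]
  rw [hadd, hint]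
  ring

/-- If `|f'| ≤ h'` on an open interval then increments of `f` are dominated by those of `h`. -/
lemma abs_sub_le_abs_sub_of_abs_deriv_le {f h f' h' : ℝ → ℝ} {a b : ℝ}
    (hf : ∀ x ∈ Ioo a b, HasDerivAt f (f' x) x) (hh : ∀ x ∈ Ioo a b, HasDerivAt h (h' x) x)
    (hle : ∀ x ∈ Ioo a b, |f' x| ≤ h' x) {x y : ℝ} (hx : x ∈ Ioo a b) (hy : y ∈ Ioo a b) :
    |f x - f y| ≤ |h x - h y| := by
  have mono : ∀ g g' : ℝ → ℝ, (∀ x ∈ Ioo a b, HasDerivAt g (g' x) x) →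
      (∀ x ∈ Ioo a b, 0 ≤ g' x) → MonotoneOn g (Ioo a b) := fun g g' hg h0 =>
    monotoneOn_of_deriv_nonneg (convex_Ioo a b)
      (fun z hz => (hg z hz).continuousAt.continuousWithinAt)
      (fun z hz => (hg z (interior_subset hz)).differentiableAt.differentiableWithinAt)
      (fun z hz => by
        rw [(hg z (interior_subset hz)).deriv]
        exact h0 z (interior_subset hz))
  have m1 := mono (fun z => h z + f z) (fun z => h' z + f' z)
    (fun z hz => (hh z hz).add (hf z hz)) fun z hz => by linarith [(abs_le.1 (hle z hz)).1]
  have m2 := mono (fun z => h z - f z) (fun z => h' z - f' z)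
    (fun z hz => (hh z hz).sub (hf z hz)) fun z hz => by linarith [(abs_le.1 (hle z hz)).2]
  rcases le_total x y with hxy | hxy
  · have e1 := m1 hx hy hxy
    have e2 := m2 hx hy hxy
    simp only at e1 e2
    rw [abs_of_nonpos (a := h x - h y) (by linarith)]
    exact abs_le.2 ⟨by linarith, by linarith⟩
  · have e1 := m1 hy hx hxy
    have e2 := m2 hy hx hxy
    simp only at e1 e2
    rw [abs_of_nonneg (a := h x - h y) (by linarith)]
    exact abs_le.2 ⟨by linarith, by linarith⟩

/-- The logarithm of the model weight `(1 + x) (log ((1 + x) / 3))² (1 - x) ^ (-u / 2)`. -/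
noncomputable def logWeight (u x : ℝ) : ℝ :=
  Real.log (1 + x) + 2 * Real.log (Real.log ((1 + x) / 3)) - u / 2 * Real.log (1 - x)

lemma hasDerivAt_logWeight (u : ℝ) {x : ℝ} (hx : x ∈ Ioo (-1 : ℝ) 1) :
    HasDerivAt (logWeight u)
      ((1 + 2 / Real.log ((1 + x) / 3)) / (1 + x) + u / 2 / (1 - x)) x := by
  have hL := log_add_div_three_lt hx
  have hL0 : Real.log ((1 + x) / 3) ≠ 0 := by linarith
  have hp : 1 + x ≠ 0 := by linarith [hx.1]
  have hm : 1 - x ≠ 0 := by linarith [hx.2]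
  have h1 := ((hasDerivAt_id x).const_add 1).log hp
  have h2 := ((hasDerivAt_log_add_div_three hx.1).log hL0).const_mul 2
  have h3 := (((hasDerivAt_id x).const_sub 1).log hm).const_mul (u / 2)
  refine ((h1.add h2).sub h3).congr_deriv ?_
  simp only [id]
  field_simp
  ring

/-- A bounded function whose derivative dominates that of `bF U - logWeight u`. -/
noncomputable def errorBound (α x : ℝ) : ℝ :=
  -(Real.log ((1 + x) / 3))⁻¹ - 1 / α * (1 - x) ^ α + x

lemma hasDerivAt_errorBound {α : ℝ} (hα : 0 < α) {x : ℝ} (hx : x ∈ Ioo (-1 : ℝ) 1) :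
    HasDerivAt (errorBound α)
      (1 / ((Real.log ((1 + x) / 3)) ^ 2 * (1 + x)) + (1 - x) ^ (α - 1) + 1) x := by
  have hL := log_add_div_three_lt hx
  have hL0 : Real.log ((1 + x) / 3) ≠ 0 := by linarith
  have hp : 1 + x ≠ 0 := by linarith [hx.1]
  have hm : 1 - x ≠ 0 := by linarith [hx.2]
  have h1 := ((hasDerivAt_log_add_div_three hx.1).inv hL0).neg
  have h2 := (((hasDerivAt_id x).const_sub 1).rpow_const (p := α) (Or.inl hm)).const_mul (1 / α)
  refine ((h1.sub h2).add (hasDerivAt_id x)).congr_deriv ?_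
  simp only [id]
  field_simp
  ring

lemma abs_errorBound_le {α : ℝ} (hα : 0 < α) (hα1 : α ≤ 1) {x : ℝ} (hx : x ∈ Ioo (-1 : ℝ) 1) :
    |errorBound α x| ≤ 4 + 2 / α := by
  have hL := log_add_div_three_lt hx
  have h1 : |(Real.log ((1 + x) / 3))⁻¹| ≤ 3 := by
    rw [abs_inv, abs_of_neg (by linarith)]
    exact inv_le_of_inv_le₀ (by norm_num) (by linarith)
  have hm : 0 < 1 - x := by linarith [hx.2]
  have h2 : (1 - x) ^ α ≤ 2 :=
    calc (1 - x) ^ α ≤ 2 ^ α := Real.rpow_le_rpow hm.le (by linarith [hx.1]) hα.le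
      _ ≤ 2 ^ (1 : ℝ) := Real.rpow_le_rpow_of_exponent_le (by norm_num) hα1
      _ = 2 := Real.rpow_one 2
  have h3 : 0 ≤ 1 / α * (1 - x) ^ α := by positivity
  have h4 : 1 / α * (1 - x) ^ α ≤ 2 / α := by
    rw [div_mul_eq_mul_div, one_mul]
    gcongr
  rw [abs_le] at h1 ⊢
  unfold errorBound
  constructor <;> linarith [hx.1, hx.2]

lemma abs_deriv_sub_le_of_nonpos {v u C₀ : ℝ} (hC₀ : 0 < C₀) {x : ℝ} (hx : x ∈ Ioc (-1 : ℝ) 0)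
    (h : |v - 2 - 4 / Real.log ((1 + x) / 3)| ≤ C₀ / (Real.log ((1 + x) / 3)) ^ 2) :
    |v / (1 - x ^ 2) - ((1 + 2 / Real.log ((1 + x) / 3)) / (1 + x) + u / 2 / (1 - x))| ≤
      C₀ * (1 / ((Real.log ((1 + x) / 3)) ^ 2 * (1 + x))) + (7 + |u|) := by
  have hL := log_add_div_three_lt ⟨hx.1, by linarith [hx.2]⟩
  set L := Real.log ((1 + x) / 3)
  have hL0 : L ≠ 0 := by linarith
  have hp : 0 < 1 + x := by linarith [hx.1]
  have hm : 1 ≤ 1 - x := by linarith [hx.2]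
  have hm0 : 1 - x ≠ 0 := by linarith
  have hfac : 1 - x ^ 2 = (1 + x) * (1 - x) := by ring
  have key : v / (1 - x ^ 2) - ((1 + 2 / L) / (1 + x) + u / 2 / (1 - x)) =
      (v - 2 - 4 / L) / ((1 + x) * (1 - x)) + (1 + 2 / L - u / 2) / (1 - x) := by
    rw [hfac]
    field_simp
    ring
  have hLi : |2 / L| ≤ 6 := by
    rw [abs_div, abs_of_neg (a := L) (by linarith), abs_two, div_le_iff₀ (by linarith)]
    linarith
  have e1 : |(v - 2 - 4 / L) / ((1 + x) * (1 - x))| ≤ C₀ * (1 / (L ^ 2 * (1 + x))) := by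
    rw [abs_div, abs_of_pos (a := (1 + x) * (1 - x)) (by positivity)]
    calc |v - 2 - 4 / L| / ((1 + x) * (1 - x)) ≤ (C₀ / L ^ 2) / ((1 + x) * 1) := by gcongr
      _ = _ := by field_simp
  have e2 : |(1 + 2 / L - u / 2) / (1 - x)| ≤ 7 + |u| := by
    rw [abs_div, abs_of_pos (a := 1 - x) (by linarith)]
    refine (div_le_self (abs_nonneg _) hm).trans ?_
    rw [abs_le] at hLi ⊢
    constructor <;> linarith [le_abs_self u, neg_abs_le u, abs_nonneg u]
  rw [key]
  exact (abs_add_le _ _).trans (add_le_add e1 e2)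

lemma abs_deriv_sub_le_of_nonneg {v u α C₀ : ℝ} (hC₀ : 0 < C₀) {x : ℝ}
    (hx : x ∈ Ico (0 : ℝ) 1) (h : |v - u| ≤ C₀ * (1 - x) ^ α) :
    |v / (1 - x ^ 2) - ((1 + 2 / Real.log ((1 + x) / 3)) / (1 + x) + u / 2 / (1 - x))| ≤
      C₀ * (1 - x) ^ (α - 1) + (7 + |u|) := by
  have hL := log_add_div_three_lt ⟨by linarith [hx.1], hx.2⟩
  set L := Real.log ((1 + x) / 3)
  have hL0 : L ≠ 0 := by linarith
  have hp : 1 ≤ 1 + x := by linarith [hx.1]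
  have hp0 : 1 + x ≠ 0 := by linarith
  have hm : 0 < 1 - x := by linarith [hx.2]
  have hfac : 1 - x ^ 2 = (1 + x) * (1 - x) := by ring
  have key : v / (1 - x ^ 2) - ((1 + 2 / L) / (1 + x) + u / 2 / (1 - x)) =
      (v - u) / ((1 + x) * (1 - x)) + (u / 2 - (1 + 2 / L)) / (1 + x) := by
    rw [hfac]
    field_simp
    ring
  have hLi : |2 / L| ≤ 6 := by
    rw [abs_div, abs_of_neg (a := L) (by linarith), abs_two, div_le_iff₀ (by linarith)]
    linarith
  have e1 : |(v - u) / ((1 + x) * (1 - x))| ≤ C₀ * (1 - x) ^ (α - 1) := by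
    rw [abs_div, abs_of_pos (a := (1 + x) * (1 - x)) (by positivity), Real.rpow_sub_one hm.ne']
    calc |v - u| / ((1 + x) * (1 - x)) ≤ (C₀ * (1 - x) ^ α) / (1 * (1 - x)) := by gcongr
      _ = _ := by rw [one_mul, mul_div_assoc]
  have e2 : |(u / 2 - (1 + 2 / L)) / (1 + x)| ≤ 7 + |u| := by
    rw [abs_div, abs_of_pos (a := 1 + x) (by linarith)]
    refine (div_le_self (abs_nonneg _) hp).trans ?_
    rw [abs_le] at hLi ⊢
    constructor <;> linarith [le_abs_self u, neg_abs_le u, abs_nonneg u]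
  rw [key]
  exact (abs_add_le _ _).trans (add_le_add e1 e2)

lemma exp_logWeight (u : ℝ) {x : ℝ} (hx : x ∈ Ioo (-1 : ℝ) 1) :
    Real.exp (logWeight u x) =
      (1 + x) * (Real.log ((1 + x) / 3)) ^ 2 / (1 - x) ^ (u / 2) := by
  have hL := log_add_div_three_lt hx
  have hp : 0 < 1 + x := by linarith [hx.1]
  have hm : 0 < 1 - x := by linarith [hx.2]
  have hsq : 0 < (Real.log ((1 + x) / 3)) ^ 2 := sq_pos_of_neg (by linarith)
  rw [logWeight, Real.exp_sub, Real.exp_add, Real.exp_log hp, Real.rpow_def_of_pos hm,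
    mul_comm (u / 2)]
  congr 2
  rw [← Real.exp_log hsq, Real.log_pow]
  norm_num

lemma exists_abs_bF_sub_logWeight_le {U : ℝ → ℝ} (hU : ContinuousOn U (Ioo (-1 : ℝ) 1))
    {u α C₀ : ℝ} (hα : 0 < α) (hα1 : α ≤ 1) (hC₀ : 0 < C₀)
    (hminus : ∀ x ∈ Ioc (-1 : ℝ) 0,
      |U x - 2 - 4 / Real.log ((1 + x) / 3)| ≤ C₀ / (Real.log ((1 + x) / 3)) ^ 2)
    (hplus : ∀ x ∈ Ico (0 : ℝ) 1, |U x - u| ≤ C₀ * (1 - x) ^ α) :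
    ∃ K, ∀ x ∈ Ioo (-1 : ℝ) 1, |bF U x - logWeight u x| ≤ K := by
  set M := C₀ + (7 + |u|) with hM
  have hMC : C₀ ≤ M := by linarith [abs_nonneg u]
  have hMu : 7 + |u| ≤ M := by linarith
  have hM0 : 0 < M := by linarith
  have hder : ∀ x ∈ Ioo (-1 : ℝ) 1,
      |U x / (1 - x ^ 2) - ((1 + 2 / Real.log ((1 + x) / 3)) / (1 + x) + u / 2 / (1 - x))| ≤
        M * (1 / ((Real.log ((1 + x) / 3)) ^ 2 * (1 + x)) + (1 - x) ^ (α - 1) + 1) := by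
    intro x hx
    have hp : 0 < 1 + x := by linarith [hx.1]
    have hm : 0 < 1 - x := by linarith [hx.2]
    have hA : 0 ≤ 1 / ((Real.log ((1 + x) / 3)) ^ 2 * (1 + x)) := by positivity
    have hB : 0 ≤ (1 - x) ^ (α - 1) := by positivity
    have hA' := mul_le_mul_of_nonneg_right hMC hA
    have hB' := mul_le_mul_of_nonneg_right hMC hB
    have hA0 := mul_nonneg hM0.le hA
    have hB0 := mul_nonneg hM0.le hB
    rcases le_total x 0 with h0 | h0
    · have := abs_deriv_sub_le_of_nonpos (u := u) hC₀ ⟨hx.1, h0⟩ (hminus x ⟨hx.1, h0⟩)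
      linarith
    · have := abs_deriv_sub_le_of_nonneg hC₀ ⟨h0, hx.2⟩ (hplus x ⟨h0, hx.2⟩)
      linarith
  have h0 : (0 : ℝ) ∈ Ioo (-1 : ℝ) 1 := by norm_num
  refine ⟨M * (2 * (4 + 2 / α)) + |bF U 0 - logWeight u 0|, fun x hx => ?_⟩
  have hcmp := abs_sub_le_abs_sub_of_abs_deriv_le
    (f := fun x => bF U x - logWeight u x) (h := fun x => M * errorBound α x)
    (fun x hx => (hasDerivAt_bF hU hx).sub (hasDerivAt_logWeight u hx))
    (fun x hx => (hasDerivAt_errorBound hα hx).const_mul M) hder hx h0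
  have hbd : |M * errorBound α x - M * errorBound α 0| ≤ M * (2 * (4 + 2 / α)) := by
    rw [← mul_sub, abs_mul, abs_of_pos hM0]
    gcongr
    refine (abs_sub _ _).trans ?_
    linarith [abs_errorBound_le hα hα1 hx, abs_errorBound_le hα hα1 h0]
  have := abs_sub_abs_le_abs_sub (bF U x - logWeight u x) (bF U 0 - logWeight u 0)
  linarith

/-- exponential bounds on `e^{±a}`, `e^{±b}` when `Ū` has logarithmic
asymptotics `2 + 4/ln((1+x)/3)` at `−1` and a power-rate limit `u₊` at `1`. -/
theorem stmt1 (U : ℝ → ℝ) (hU : ContinuousOn U (Ioo (-1:ℝ) 1))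
    (up α C₀ : ℝ) (hα : 0 < α) (hα1 : α ≤ 1) (hC₀ : 0 < C₀)
    (hminus : ∀ x ∈ Ioc (-1:ℝ) 0,
      |U x - 2 - 4 / Real.log ((1+x)/3)| ≤ C₀ / (Real.log ((1+x)/3))^2)
    (hplus : ∀ x ∈ Ico (0:ℝ) 1, |U x - up| ≤ C₀ * (1-x) ^ α) :
    ∃ C > 0, ∀ x ∈ Ioo (-1:ℝ) 1,
      Real.exp (bF U x) ≤ C * (Real.log ((1+x)/3))^2 * (1+x) * (1-x) ^ (-(up/2)) ∧
      Real.exp (-(bF U x)) ≤ C * (1-x) ^ (up/2) / ((Real.log ((1+x)/3))^2 * (1+x)) ∧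
      Real.exp (aF U x) ≤ C * (Real.log ((1+x)/3))^2 * (1-x) ^ (-1 - up/2) ∧
      Real.exp (-(aF U x)) ≤ C * (1-x) ^ (1 + up/2) / (Real.log ((1+x)/3))^2 := by
  obtain ⟨K, hK⟩ := exists_abs_bF_sub_logWeight_le hU hα hα1 hC₀ hminus hplus
  refine ⟨Real.exp K, Real.exp_pos K, fun x hx => ?_⟩
  obtain ⟨hlo, hhi⟩ := abs_le.1 (hK x hx)
  have hL := log_add_div_three_lt hx
  have hL0 : Real.log ((1 + x) / 3) ≠ 0 := by linarith
  have hp : 0 < 1 + x := by linarith [hx.1]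
  have hm : 0 < 1 - x := by linarith [hx.2]
  have hP : 0 < (1 - x) ^ (up / 2) := Real.rpow_pos_of_pos hm _
  have hb : Real.exp (bF U x) ≤ Real.exp K * Real.exp (logWeight up x) := by
    rw [← Real.exp_add, Real.exp_le_exp]
    linarith
  have hnb : Real.exp (-bF U x) ≤ Real.exp K / Real.exp (logWeight up x) := by
    rw [← Real.exp_sub, Real.exp_le_exp]
    linarith
  have hq : Real.exp (Real.log (1 - x ^ 2)) = (1 + x) * (1 - x) := by
    rw [Real.exp_log (one_sub_sq_pos hx)]
    ring
  rw [exp_logWeight up hx] at hb hnb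
  rw [aF_eq_bF_sub_log hU hx, neg_sub, Real.exp_sub, sub_eq_add_neg (Real.log _), Real.exp_add, hq,
    Real.rpow_sub hm, Real.rpow_add hm, Real.rpow_neg hm.le, Real.rpow_neg hm.le, Real.rpow_one]
  refine ⟨hb.trans_eq ?_, hnb.trans_eq ?_, ?_, ?_⟩
  · field_simp
  · field_simp
  · refine (div_le_div_of_nonneg_right hb (by positivity)).trans_eq ?_
    field_simp
  · refine (mul_le_mul_of_nonneg_left hnb (by positivity)).trans_eq ?_
    field_simp
end

section
/- Let ε ∈ (0,1/2). Suppose Ũθ and Ṽθ are C¹ on (−1,1), C³ on (−1/2,1/2), with finite log-weighted M₁-norms, and Ũφ, Ṽφ ∈ C²(−1,1) have finite M₂-norms. Then ψ[Ũφ,Ṽφ] extends continuously to [−1,1]; define Qθ(x) = ½Ũθ(x)Ṽθ(x) + ψ[Ũφ,Ṽφ](x) − ½(1−x)ψ[Ũφ,Ṽφ](−1) − ½(1+x)ψ[Ũφ,Ṽφ](1) + ¼(ŨθṼθ)''(0)(1−x²) and Qφ(x) = Ũθ(x)Ṽφ'(x). Then Qθ(x) → 0 as x → ±1, Qθ''(0)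 = 0, and there exists C depending only on ε such that the log-weighted N₁-norm of Qθ plus the N₂-norm of Qφ is at most C·(log-weighted M₁-norm of Ũθ + M₂-norm of Ũφ)·(log-weighted M₁-norm of Ṽθ + M₂-norm of Ṽφ). -/
open Set Filter

/-- The primitive from `0` of a function continuous on `(-1, 1)` is differentiable there. -/
lemma hasDerivAt_integral_of_continuousOn_Ioo {f : ℝ → ℝ} (hf : ContinuousOn f (Ioo (-1) 1))
    {x : ℝ} (hx : x ∈ Ioo (-1 : ℝ) 1) :
    HasDerivAt (fun y => ∫ s in (0 : ℝ)..y, f s) (f x) x := by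
  refine intervalIntegral.integral_hasDerivAt_right ?_ ?_ ?_
  · refine (hf.mono ?_).intervalIntegrable
    exact (ordConnected_Ioo.uIcc_subset (by simp) hx)
  · exact hf.stronglyMeasurableAtFilter isOpen_Ioo x hx
  · exact hf.continuousAt (isOpen_Ioo.mem_nhds hx)

lemma abs_integral_le_rpow_of_nonneg {f : ℝ → ℝ} {A p t : ℝ} (hp : 0 < p) (hA : 0 ≤ A)
    (hb : ∀ s ∈ Ioo (-1 : ℝ) 1, |f s| ≤ A * (1 - |s|) ^ (-p - 1)) (ht0 : 0 ≤ t) (ht1 : t < 1) :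
    |∫ s in (0 : ℝ)..t, f s| ≤ A / p * (1 - |t|) ^ (-p) := by
  have hd : ∀ s ∈ uIcc 0 t,
      HasDerivAt (fun s : ℝ => A / p * (1 - s) ^ (-p)) (A * (1 - s) ^ (-p - 1)) s := by
    intro s hs
    rw [uIcc_of_le ht0] at hs
    have h1 : (1 - s) ≠ 0 := by linarith [hs.2]
    have := (((hasDerivAt_id s).const_sub 1).rpow_const (p := -p) (Or.inl h1)).const_mul (A / p)
    refine this.congr_deriv ?_
    field_simp
    simp [id]
  have hc : ContinuousOn (fun s : ℝ => A * (1 - s) ^ (-p - 1)) (uIcc 0 t) := by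
    intro s hs
    rw [uIcc_of_le ht0] at hs
    have h1 : (1 - s) ≠ 0 := by linarith [hs.2]
    exact (((continuousAt_const.sub continuousAt_id).rpow_const (Or.inl h1)).const_mul
      A).continuousWithinAt
  have h := intervalIntegral.norm_integral_le_of_norm_le (f := f) (μ := MeasureTheory.volume)
    (g := fun s : ℝ => A * (1 - s) ^ (-p - 1)) ht0
    (Eventually.of_forall fun s hs => ?_) hc.intervalIntegrable
  · rw [intervalIntegral.integral_eq_sub_of_hasDerivAt hd hc.intervalIntegrable] at h
    rw [Real.norm_eq_abs] at h
    rw [abs_of_nonneg ht0]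
    simp only [sub_zero, Real.one_rpow] at h
    have : 0 ≤ A / p := by positivity
    linarith
  · have := hb s ⟨by linarith [hs.1], by linarith [hs.2]⟩
    rwa [abs_of_pos hs.1] at this

/-- Integrating a blow-up rate of order `-p-1` at `±1` gives a blow-up rate of order `-p`. -/
lemma abs_integral_le_rpow {f : ℝ → ℝ} {A p t : ℝ} (hp : 0 < p) (hA : 0 ≤ A)
    (hb : ∀ s ∈ Ioo (-1 : ℝ) 1, |f s| ≤ A * (1 - |s|) ^ (-p - 1)) (ht : t ∈ Ioo (-1 : ℝ) 1) :
    |∫ s in (0 : ℝ)..t, f s| ≤ A / p * (1 - |t|) ^ (-p) := by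
  rcases le_total 0 t with h | h
  · exact abs_integral_le_rpow_of_nonneg hp hA hb h ht.2
  · have := abs_integral_le_rpow_of_nonneg (f := fun s => f (-s)) (t := -t) hp hA
      (fun s hs => by
        simpa using hb (-s) ⟨by linarith [hs.2], by linarith [hs.1]⟩)
      (by linarith) (by linarith [ht.1])
    rw [intervalIntegral.integral_comp_neg, intervalIntegral.integral_symm] at this
    simpa using this

lemma intervalIntegrable_one_sub_rpow {δ : ℝ} (hδ : 0 < δ) (A a b : ℝ) :
    IntervalIntegrable (fun l : ℝ => A * (1 - l) ^ (δ - 1)) MeasureTheory.volume a b := by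
  have := (intervalIntegral.intervalIntegrable_rpow' (r := δ - 1) (by linarith)
    (a := 1 - a) (b := 1 - b)).comp_sub_left 1
  simpa using this.const_mul A

lemma intervalIntegrable_zero_one_of_abs_le_rpow {g : ℝ → ℝ} {A δ : ℝ} (hδ : 0 < δ)
    (hg : ContinuousOn g (Ioo (-1) 1))
    (hb : ∀ s ∈ Ioo (-1 : ℝ) 1, |g s| ≤ A * (1 - |s|) ^ (δ - 1)) :
    IntervalIntegrable g MeasureTheory.volume 0 1 := by
  have h := intervalIntegrable_one_sub_rpow hδ A 0 1
  rw [intervalIntegrable_iff_integrableOn_Ioo_of_le zero_le_one] at h ⊢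
  refine MeasureTheory.Integrable.mono' h
    ((hg.mono (Ioo_subset_Ioo_left (by norm_num))).aestronglyMeasurable measurableSet_Ioo) ?_
  refine MeasureTheory.ae_restrict_of_forall_mem measurableSet_Ioo fun s hs => ?_
  have := hb s ⟨by linarith [hs.1], hs.2⟩
  rwa [abs_of_pos hs.1] at this

lemma intervalIntegrable_of_abs_le_rpow {g : ℝ → ℝ} {A δ : ℝ} (hδ : 0 < δ)
    (hg : ContinuousOn g (Ioo (-1) 1))
    (hb : ∀ s ∈ Ioo (-1 : ℝ) 1, |g s| ≤ A * (1 - |s|) ^ (δ - 1)) :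
    IntervalIntegrable g MeasureTheory.volume (-1) 1 := by
  have h2 := intervalIntegrable_zero_one_of_abs_le_rpow (g := fun s => g (-s)) hδ
    (hg.comp continuous_neg.continuousOn
      fun s hs => ⟨by linarith [hs.2], by linarith [hs.1]⟩)
    (fun s hs => by simpa using hb (-s) ⟨by linarith [hs.2], by linarith [hs.1]⟩)
  have h3 := ((IntervalIntegrable.iff_comp_neg (f := g) (a := 0) (b := -1)).2 (by simpa using h2))
  exact h3.symm.trans (intervalIntegrable_zero_one_of_abs_le_rpow hδ hg hb)

/-- Hölder estimate at the endpoint `1` for the primitive of a function with an integrable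
singularity. -/
lemma abs_integral_one_sub_integral_le {g : ℝ → ℝ} {A δ x : ℝ} (hδ : 0 < δ)
    (hg : ContinuousOn g (Ioo (-1) 1))
    (hb : ∀ s ∈ Ioo (-1 : ℝ) 1, |g s| ≤ A * (1 - |s|) ^ (δ - 1)) (hx0 : 0 ≤ x) (hx1 : x ≤ 1) :
    |(∫ l in (0 : ℝ)..1, g l) - ∫ l in (0 : ℝ)..x, g l| ≤ A / δ * (1 - x) ^ δ := by
  have hi := intervalIntegrable_zero_one_of_abs_le_rpow hδ hg hb
  rw [intervalIntegral.integral_interval_sub_left hi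
    (hi.mono_set (by rw [uIcc_of_le hx0, uIcc_of_le zero_le_one]; exact Icc_subset_Icc_right hx1))]
  have h := intervalIntegral.norm_integral_le_of_norm_le (f := g) (μ := MeasureTheory.volume)
    (g := fun s : ℝ => A * (1 - s) ^ (δ - 1)) hx1 ?_ (intervalIntegrable_one_sub_rpow hδ A x 1)
  · rw [intervalIntegral.integral_const_mul,
      intervalIntegral.integral_comp_sub_left (fun s : ℝ => s ^ (δ - 1)) 1,
      integral_rpow (Or.inl (by linarith))] at h
    rw [← Real.norm_eq_abs]
    refine h.trans (le_of_eq ?_)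
    simp [hδ.ne']
    ring
  · have h1 : ∀ᵐ s : ℝ, s ≠ 1 := by simp [MeasureTheory.ae_iff]
    filter_upwards [h1] with s hs1 hs
    have hs0 : 0 < s := by linarith [hs.1]
    have := hb s ⟨by linarith, lt_of_le_of_ne hs.2 hs1⟩
    rwa [abs_of_pos hs0] at this

lemma abs_integral_neg_one_sub_integral_le {g : ℝ → ℝ} {A δ x : ℝ} (hδ : 0 < δ)
    (hg : ContinuousOn g (Ioo (-1) 1))
    (hb : ∀ s ∈ Ioo (-1 : ℝ) 1, |g s| ≤ A * (1 - |s|) ^ (δ - 1)) (hx0 : x ≤ 0) (hx1 : -1 ≤ x) :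
    |(∫ l in (0 : ℝ)..(-1), g l) - ∫ l in (0 : ℝ)..x, g l| ≤ A / δ * (1 + x) ^ δ := by
  have := abs_integral_one_sub_integral_le (g := fun s => g (-s)) (x := -x) hδ
    (hg.comp continuous_neg.continuousOn
      fun s hs => ⟨by linarith [hs.2], by linarith [hs.1]⟩)
    (fun s hs => by simpa using hb (-s) ⟨by linarith [hs.2], by linarith [hs.1]⟩)
    (by linarith) (by linarith)
  rw [intervalIntegral.integral_comp_neg, intervalIntegral.integral_comp_neg,
    intervalIntegral.integral_symm, intervalIntegral.integral_symm (-0) (-(-x))] at this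
  simp only [neg_neg, neg_zero, sub_neg_eq_add] at this
  rwa [neg_add_eq_sub, abs_sub_comm] at this

lemma one_third_le_abs_log {x : ℝ} (hx : x ∈ Ioo (-1 : ℝ) 1) :
    1 / 3 ≤ |Real.log ((1 + x) / 3)| := by
  have h0 : 0 < (1 + x) / 3 := by linarith [hx.1]
  have := Real.log_le_sub_one_of_pos h0
  rw [abs_of_nonpos (by linarith [hx.2])]
  linarith [hx.2]

lemma log_sq_mul_rpow_le {x δ : ℝ} (hx : x ∈ Ioo (-1 : ℝ) 1) (hδ : 0 < δ) (hδ1 : δ ≤ 1) :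
    Real.log ((1 + x) / 3) ^ 2 * (1 + x) ^ δ ≤ 12 / δ ^ 2 := by
  have h0 : 0 < (1 + x) / 3 := by linarith [hx.1]
  have h := Real.abs_log_mul_self_rpow_lt ((1 + x) / 3) (δ / 2) h0 (by linarith [hx.2])
    (by linarith)
  have h2 : (1 + x) ^ δ ≤ 3 * (((1 + x) / 3) ^ (δ / 2)) ^ 2 := by
    rw [← Real.rpow_natCast, ← Real.rpow_mul h0.le]
    have : (1 + x) = ((1 + x) / 3) * 3 := by ring
    conv_lhs => rw [this, Real.mul_rpow h0.le (by norm_num)]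
    have h3 : (3 : ℝ) ^ δ ≤ 3 := by
      simpa using Real.rpow_le_rpow_of_exponent_le (by norm_num : (1 : ℝ) ≤ 3) hδ1
    have h4 : δ / 2 * ((2 : ℕ) : ℝ) = δ := by push_cast; ring
    rw [h4, mul_comm]
    exact mul_le_mul_of_nonneg_right h3 (by positivity)
  have h3 : (Real.log ((1 + x) / 3) * ((1 + x) / 3) ^ (δ / 2)) ^ 2 ≤ (1 / (δ / 2)) ^ 2 := by
    rw [sq_le_sq, abs_of_pos (show 0 < 1 / (δ / 2) by positivity)]
    exact h.le
  calc _ ≤ Real.log ((1 + x) / 3) ^ 2 * (3 * (((1 + x) / 3) ^ (δ / 2)) ^ 2) := by gcongr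
    _ = 3 * (Real.log ((1 + x) / 3) * ((1 + x) / 3) ^ (δ / 2)) ^ 2 := by ring
    _ ≤ 3 * (1 / (δ / 2)) ^ 2 := by gcongr
    _ = _ := by field_simp; norm_num

lemma abs_log_mul_abs_le {x ε M u : ℝ} (hx : x ∈ Ioo (-1 : ℝ) 1)
    (h : |Real.log ((1 + x) / 3)| * (1 - x) ^ (-1 + 2 * ε) * |u| ≤ M) :
    |Real.log ((1 + x) / 3)| * |u| ≤ M * (1 - x) ^ (1 - 2 * ε) := by
  have h1 : 0 < 1 - x := by linarith [hx.2]
  have h2 : (1 - x) ^ (-1 + 2 * ε) * (1 - x) ^ (1 - 2 * ε) = 1 := by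
    rw [← Real.rpow_add h1]; simp
  have h3 := mul_le_mul_of_nonneg_right h (Real.rpow_nonneg h1.le (1 - 2 * ε))
  calc _ = |Real.log ((1 + x) / 3)| * |u| * ((1 - x) ^ (-1 + 2 * ε) * (1 - x) ^ (1 - 2 * ε)) := by
        rw [h2, mul_one]
    _ ≤ _ := by linarith

lemma rpow_le_two {y δ : ℝ} (hy : 0 ≤ y) (hy2 : y ≤ 2) (hδ : 0 ≤ δ) (hδ1 : δ ≤ 1) :
    y ^ δ ≤ 2 :=
  calc y ^ δ ≤ (2 : ℝ) ^ δ := Real.rpow_le_rpow hy hy2 hδ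
    _ ≤ 2 := by simpa using Real.rpow_le_rpow_of_exponent_le (by norm_num : (1 : ℝ) ≤ 2) hδ1

lemma abs_le_of_log_weight {x ε M u : ℝ} (hε : 0 < ε) (hε2 : ε < 1 / 2) (hM : 0 ≤ M)
    (hx : x ∈ Ioo (-1 : ℝ) 1)
    (h : |Real.log ((1 + x) / 3)| * (1 - x) ^ (-1 + 2 * ε) * |u| ≤ M) : |u| ≤ 6 * M := by
  have h1 := abs_log_mul_abs_le hx h
  have h2 := rpow_le_two (y := 1 - x) (δ := 1 - 2 * ε) (by linarith [hx.2]) (by linarith [hx.1])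
    (by linarith) (by linarith)
  have h3 := mul_le_mul_of_nonneg_left h2 hM
  have h4 := mul_le_mul_of_nonneg_right (one_third_le_abs_log hx) (abs_nonneg u)
  linarith

lemma abs_le_of_log_sq_weight {x ε M u : ℝ} (hε : 0 < ε) (hε2 : ε < 1 / 2)
    (hx : x ∈ Ioo (-(1 : ℝ) / 2) (1 / 2))
    (h : (1 + x) * Real.log ((1 + x) / 3) ^ 2 * (1 - x) ^ (2 * ε) * |u| ≤ M) :
    |u| ≤ 36 * M := by
  obtain ⟨hx1, hx2⟩ := hx
  have h1 := one_third_le_abs_log (x := x) ⟨by linarith, by linarith⟩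
  have h2 : 1 / 9 ≤ Real.log ((1 + x) / 3) ^ 2 := by
    rw [← sq_abs]; nlinarith
  have h3 : 1 / 2 ≤ (1 - x) ^ (2 * ε) :=
    calc (1 / 2 : ℝ) ≤ (1 / 2 : ℝ) ^ (2 * ε) := by
          simpa using Real.rpow_le_rpow_of_exponent_ge (by norm_num : (0 : ℝ) < 1 / 2)
            (by norm_num) (by linarith : 2 * ε ≤ 1)
      _ ≤ _ := Real.rpow_le_rpow (by norm_num) (by linarith) (by linarith)
  have h4 : 1 / 2 * (1 / 9) * (1 / 2) * |u| ≤
      (1 + x) * Real.log ((1 + x) / 3) ^ 2 * (1 - x) ^ (2 * ε) * |u| := by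
    have : 1 / 2 ≤ 1 + x := by linarith
    gcongr
  linarith

lemma deriv_deriv_of_hasDerivAt {f f' f'' : ℝ → ℝ} {s : Set ℝ} (hs : IsOpen s)
    (h : ∀ x ∈ s, HasDerivAt f (f' x) x) (h' : ∀ x ∈ s, HasDerivAt f' (f'' x) x)
    {x : ℝ} (hx : x ∈ s) : deriv (deriv f) x = f'' x := by
  have : deriv f =ᶠ[nhds x] f' := by
    filter_upwards [hs.mem_nhds hx] with y hy using (h y hy).deriv
  rw [this.deriv_eq, (h' x hx).deriv]

/-- The error of linear interpolation at `±1` of the primitive of a function with integrable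
singularities at `±1`, in the log-weighted norm. -/
lemma log_sq_mul_abs_sub_interpolation_le {g : ℝ → ℝ} {A δ x : ℝ} (hA : 0 ≤ A) (hδ : 0 < δ)
    (hδ1 : δ ≤ 1) (hg : ContinuousOn g (Ioo (-1) 1))
    (hb : ∀ s ∈ Ioo (-1 : ℝ) 1, |g s| ≤ A * (1 - |s|) ^ (δ - 1)) (hx : x ∈ Ioo (-1 : ℝ) 1) :
    Real.log ((1 + x) / 3) ^ 2 * (1 - x) ^ (-δ) *
      |(∫ l in (0 : ℝ)..x, g l) - (∫ l in (0 : ℝ)..(-1), g l) * (1 - x) / 2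
        - (∫ l in (0 : ℝ)..1, g l) * (1 + x) / 2| ≤ 36 * A / δ ^ 3 := by
  obtain ⟨hx1, hx2⟩ := hx
  set B := A / δ with hB
  have hB0 : 0 ≤ B := by positivity
  have hp := abs_integral_one_sub_integral_le hδ hg hb le_rfl zero_le_one
  have hm := abs_integral_neg_one_sub_integral_le hδ hg hb le_rfl (by norm_num)
  simp only [intervalIntegral.integral_same, sub_zero, add_zero, Real.one_rpow, mul_one] at hp hm
  set P := ∫ l in (0 : ℝ)..1, g l
  set N := ∫ l in (0 : ℝ)..(-1), g l
  set p := ∫ l in (0 : ℝ)..x, g l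
  have hd : 36 * A / δ ^ 3 = 3 * B * (12 / δ ^ 2) := by rw [hB]; field_simp; ring
  have hd1 : 12 ≤ 12 / δ ^ 2 := by
    rw [le_div_iff₀ (by positivity)]; nlinarith
  rw [hd]
  rcases le_total 0 x with h | h
  · have h1 := abs_integral_one_sub_integral_le hδ hg hb h hx2.le
    have hw : 1 - x ≤ (1 - x) ^ δ := by
      simpa using Real.rpow_le_rpow_of_exponent_ge (by linarith : 0 < 1 - x) (by linarith) hδ1
    have hD : |p - N * (1 - x) / 2 - P * (1 + x) / 2| ≤ 3 * B * (1 - x) ^ δ := by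
      have e : p - N * (1 - x) / 2 - P * (1 + x) / 2 =
        -(P - p) + (P - N) / 2 * (1 - x) := by ring
      have h2 : |P - N| ≤ 2 * B := (abs_sub _ _).trans (by linarith)
      calc _ ≤ |P - p| + |P - N| / 2 * (1 - x) := by
            rw [e]
            refine (abs_add_le _ _).trans (le_of_eq ?_)
            rw [abs_neg, abs_mul, abs_div, abs_of_pos (by linarith : 0 < 1 - x), abs_two]
        _ ≤ B * (1 - x) ^ δ + 2 * B / 2 * (1 - x) ^ δ := by gcongr
        _ ≤ _ := by nlinarith [mul_nonneg hB0 (by linarith : 0 ≤ (1 - x) ^ δ)]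
    have hL : Real.log ((1 + x) / 3) ^ 2 ≤ 12 := by
      have := log_sq_mul_rpow_le (x := x) ⟨hx1, hx2⟩ one_pos le_rfl
      rw [Real.rpow_one] at this
      nlinarith [sq_nonneg (Real.log ((1 + x) / 3))]
    have hi : (1 - x) ^ (-δ) * (1 - x) ^ δ = 1 := by
      rw [← Real.rpow_add (by linarith)]; simp
    calc _ ≤ Real.log ((1 + x) / 3) ^ 2 * (1 - x) ^ (-δ) * (3 * B * (1 - x) ^ δ) := by
          have : 0 ≤ (1 - x) ^ (-δ) := Real.rpow_nonneg (by linarith) _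
          gcongr
      _ = 3 * B * Real.log ((1 + x) / 3) ^ 2 * ((1 - x) ^ (-δ) * (1 - x) ^ δ) := by ring
      _ = 3 * B * Real.log ((1 + x) / 3) ^ 2 := by rw [hi, mul_one]
      _ ≤ _ := by gcongr; linarith
  · have h1 := abs_integral_neg_one_sub_integral_le hδ hg hb h hx1.le
    have hw : 1 + x ≤ (1 + x) ^ δ := by
      simpa using Real.rpow_le_rpow_of_exponent_ge (by linarith : 0 < 1 + x) (by linarith) hδ1
    have hw0 : 0 ≤ (1 + x) ^ δ := Real.rpow_nonneg (by linarith) _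
    have hD : |p - N * (1 - x) / 2 - P * (1 + x) / 2| ≤ 3 * B * (1 + x) ^ δ := by
      have e : p - N * (1 - x) / 2 - P * (1 + x) / 2 =
        -(N - p) + -(P - N) / 2 * (1 + x) := by ring
      have h2 : |P - N| ≤ 2 * B := (abs_sub _ _).trans (by linarith)
      calc _ ≤ |N - p| + |P - N| / 2 * (1 + x) := by
            rw [e]
            refine (abs_add_le _ _).trans (le_of_eq ?_)
            rw [abs_neg, abs_mul, abs_div, abs_neg, abs_of_pos (by linarith : 0 < 1 + x), abs_two]
        _ ≤ B * (1 + x) ^ δ + 2 * B / 2 * (1 + x) ^ δ := by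
            gcongr
            linarith
        _ ≤ _ := by nlinarith [mul_nonneg hB0 hw0]
    have hL := log_sq_mul_rpow_le (x := x) ⟨hx1, hx2⟩ hδ hδ1
    have hi : (1 - x) ^ (-δ) ≤ 1 := Real.rpow_le_one_of_one_le_of_nonpos (by linarith) (by linarith)
    calc _ ≤ Real.log ((1 + x) / 3) ^ 2 * 1 * (3 * B * (1 + x) ^ δ) := by
          gcongr
      _ = 3 * B * (Real.log ((1 + x) / 3) ^ 2 * (1 + x) ^ δ) := by ring
      _ ≤ _ := by gcongr

/-- A bound in the log-weighted norm forces vanishing at `-1`. -/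
lemma tendsto_neg_one_of_log_weight {Q : ℝ → ℝ} {δ K : ℝ} (hδ : 0 ≤ δ) (hδ1 : δ ≤ 1)
    (h : ∀ x ∈ Ioo (-1 : ℝ) 1, Real.log ((1 + x) / 3) ^ 2 * (1 - x) ^ (-δ) * |Q x| ≤ K) :
    Tendsto Q (nhdsWithin (-1) (Ioo (-1) 1)) (nhds 0) := by
  have h0 : Tendsto (fun x : ℝ => (1 + x) / 3) (nhdsWithin (-1) (Ioo (-1) 1))
      (nhdsWithin 0 (Ioi 0)) := by
    refine tendsto_nhdsWithin_iff.2 ⟨?_, ?_⟩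
    · have : Tendsto (fun x : ℝ => (1 + x) / 3) (nhds (-1)) (nhds ((1 + -1) / 3)) :=
        Continuous.tendsto (by fun_prop) _
      simp only [add_neg_cancel, zero_div] at this
      exact this.mono_left nhdsWithin_le_nhds
    · filter_upwards [self_mem_nhdsWithin] with x hx
      simp only [mem_Ioi]; linarith [hx.1]
  have h1 : Tendsto (fun x : ℝ => Real.log ((1 + x) / 3) ^ 2) (nhdsWithin (-1) (Ioo (-1) 1))
      atTop := by
    have := (tendsto_pow_atTop two_ne_zero).comp
      (tendsto_abs_atBot_atTop.comp (Real.tendsto_log_nhdsGT_zero.comp h0))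
    refine this.congr fun x => ?_
    simp [Function.comp]
  have h2 := (h1.inv_tendsto_atTop).const_mul (2 * K)
  rw [mul_zero] at h2
  refine squeeze_zero_norm' ?_ h2
  filter_upwards [self_mem_nhdsWithin] with x hx
  have hl := one_third_le_abs_log hx
  have hL : 0 < Real.log ((1 + x) / 3) ^ 2 := by rw [← sq_abs]; nlinarith
  have h1x : 0 < 1 - x := by linarith [hx.2]
  have hw := rpow_le_two (y := 1 - x) h1x.le (by linarith [hx.1]) hδ hδ1
  have hw0 : 0 < (1 - x) ^ δ := Real.rpow_pos_of_pos h1x _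
  have hh := h x hx
  rw [Real.rpow_neg h1x.le, mul_assoc, mul_comm, mul_assoc] at hh
  have hq : |Q x| * Real.log ((1 + x) / 3) ^ 2 ≤ K * (1 - x) ^ δ := by
    rw [inv_mul_le_iff₀ hw0] at hh
    linarith
  have hK : 0 ≤ K := by
    by_contra! hK
    nlinarith [mul_nonneg (abs_nonneg (Q x)) hL.le, mul_neg_of_neg_of_pos hK hw0]
  rw [Real.norm_eq_abs, Pi.inv_apply, ← div_eq_mul_inv, le_div_iff₀ hL]
  nlinarith

/-- A bound in the log-weighted norm forces vanishing at `1`. -/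
lemma tendsto_one_of_log_weight {Q : ℝ → ℝ} {δ K : ℝ} (hδ : 0 < δ)
    (h : ∀ x ∈ Ioo (-1 : ℝ) 1, Real.log ((1 + x) / 3) ^ 2 * (1 - x) ^ (-δ) * |Q x| ≤ K) :
    Tendsto Q (nhdsWithin 1 (Ioo (-1) 1)) (nhds 0) := by
  have h2 : Tendsto (fun x : ℝ => 9 * K * (1 - x) ^ δ) (nhdsWithin 1 (Ioo (-1) 1)) (nhds 0) := by
    have : Tendsto (fun x : ℝ => 9 * K * (1 - x) ^ δ) (nhds 1) (nhds (9 * K * (1 - 1) ^ δ)) :=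
      (((continuous_const.sub continuous_id).rpow_const
        fun _ => Or.inr hδ.le).const_mul (9 * K)).tendsto 1
    rw [sub_self, Real.zero_rpow hδ.ne', mul_zero] at this
    exact this.mono_left nhdsWithin_le_nhds
  refine squeeze_zero_norm' ?_ h2
  filter_upwards [self_mem_nhdsWithin] with x hx
  have hl := one_third_le_abs_log hx
  have hL : 1 / 9 ≤ Real.log ((1 + x) / 3) ^ 2 := by rw [← sq_abs]; nlinarith
  have h1x : 0 < 1 - x := by linarith [hx.2]
  have hw0 : 0 < (1 - x) ^ δ := Real.rpow_pos_of_pos h1x _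
  have hh := h x hx
  rw [Real.rpow_neg h1x.le, mul_assoc, mul_comm, mul_assoc, inv_mul_le_iff₀ hw0] at hh
  rw [Real.norm_eq_abs]
  nlinarith [mul_le_mul_of_nonneg_left hL (abs_nonneg (Q x))]

lemma one_sub_sq_rpow_le {p s : ℝ} (hp : 0 ≤ p) (hs : s ∈ Ioo (-1 : ℝ) 1) :
    (1 - s ^ 2) ^ (-p) ≤ (1 - |s|) ^ (-p) := by
  have h := abs_lt.2 hs
  refine Real.rpow_le_rpow_of_nonpos (by linarith) ?_ (by linarith)
  rw [← sq_abs]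
  nlinarith [abs_nonneg s]

/-- Size of the integrand defining `ψ`. -/
lemma abs_integrand_le {ε MU MV s u v : ℝ} (hε : 0 < ε) (hs : s ∈ Ioo (-1 : ℝ) 1)
    (hMU : 0 ≤ MU) (hu : (1 - s ^ 2) ^ ε * |u| ≤ MU)
    (hv : (1 - s ^ 2) ^ (1 + ε) * |v| ≤ MV) :
    |2 * u * v / (1 - s ^ 2)| ≤ 2 * (MU * MV) * (1 - |s|) ^ (-(1 + 2 * ε) - 1) := by
  have hs2 : 0 < 1 - s ^ 2 := by nlinarith [hs.1, hs.2]
  have hMV : 0 ≤ MV := le_trans (by positivity) hv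
  have h1 := mul_le_mul hu hv (by positivity) hMU
  have h2 : (1 - s ^ 2) ^ ε * (1 - s ^ 2) ^ (1 + ε) * (1 - s ^ 2) * (1 - s ^ 2) ^ (-(2 + 2 * ε))
      = 1 := by
    conv_lhs => enter [1, 2]; rw [← Real.rpow_one (1 - s ^ 2)]
    rw [← Real.rpow_add hs2, ← Real.rpow_add hs2, ← Real.rpow_add hs2]
    ring_nf
    simp
  have h3 := one_sub_sq_rpow_le (p := 2 + 2 * ε) (by linarith) hs
  have e : -(1 + 2 * ε) - 1 = -(2 + 2 * ε) := by ring
  rw [e]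
  refine le_trans ?_ (mul_le_mul_of_nonneg_left h3 (by positivity))
  rw [abs_div, abs_of_pos hs2, abs_mul, abs_mul, abs_two, div_le_iff₀ hs2]
  calc 2 * |u| * |v| = 2 * |u| * |v| * ((1 - s ^ 2) ^ ε * (1 - s ^ 2) ^ (1 + ε) * (1 - s ^ 2) *
        (1 - s ^ 2) ^ (-(2 + 2 * ε))) := by rw [h2, mul_one]
    _ = 2 * ((1 - s ^ 2) ^ ε * |u| * ((1 - s ^ 2) ^ (1 + ε) * |v|)) *
        (1 - s ^ 2) ^ (-(2 + 2 * ε)) * (1 - s ^ 2) := by ring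
    _ ≤ _ := by gcongr

lemma rpow_neg_le_of_half_le {y p : ℝ} (hy : 1 / 2 ≤ y) (hp : 0 ≤ p) : y ^ (-p) ≤ 2 ^ p := by
  have := Real.rpow_le_rpow_of_nonpos (by norm_num) hy (by linarith : -p ≤ 0)
  rwa [one_div, Real.inv_rpow two_pos.le, Real.rpow_neg two_pos.le, inv_inv] at this

lemma log_sq_mul_abs_mul_le {x ε M N u v : ℝ} (hε : 0 < ε) (hε2 : ε < 1 / 2) (hM : 0 ≤ M)
    (hx : x ∈ Ioo (-1 : ℝ) 1)
    (hu : |Real.log ((1 + x) / 3)| * (1 - x) ^ (-1 + 2 * ε) * |u| ≤ M)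
    (hv : |Real.log ((1 + x) / 3)| * (1 - x) ^ (-1 + 2 * ε) * |v| ≤ N) :
    Real.log ((1 + x) / 3) ^ 2 * (1 - x) ^ (-1 + 2 * ε) * |u * v| ≤ 2 * (M * N) := by
  have h1x : 0 < 1 - x := by linarith [hx.2]
  have hN : 0 ≤ N := le_trans (by positivity) hv
  have h1 := mul_le_mul hu (abs_log_mul_abs_le hx hv) (by positivity) hM
  have h2 := rpow_le_two (y := 1 - x) (δ := 1 - 2 * ε) h1x.le (by linarith [hx.1])
    (by linarith) (by linarith)
  rw [abs_mul, ← sq_abs]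
  nlinarith [mul_le_mul_of_nonneg_left h2 (mul_nonneg hM hN)]

lemma log_sq_mul_one_sub_sq_le {x ε : ℝ} (hε : 0 < ε) (hε2 : ε < 1 / 2)
    (hx : x ∈ Ioo (-1 : ℝ) 1) :
    Real.log ((1 + x) / 3) ^ 2 * (1 - x) ^ (-1 + 2 * ε) * (1 - x ^ 2) ≤ 24 := by
  have h1x : 0 < 1 - x := by linarith [hx.2]
  have h1 := log_sq_mul_rpow_le hx one_pos le_rfl
  rw [Real.rpow_one] at h1
  have h2 := rpow_le_two (y := 1 - x) (δ := 2 * ε) h1x.le (by linarith [hx.1])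
    (by linarith) (by linarith)
  have e : (1 - x) ^ (-1 + 2 * ε) * (1 - x) = (1 - x) ^ (2 * ε) := by
    conv_lhs => enter [2]; rw [← Real.rpow_one (1 - x)]
    rw [← Real.rpow_add h1x]; ring_nf
  have h1' : 0 < 1 + x := by linarith [hx.1]
  calc _ = Real.log ((1 + x) / 3) ^ 2 * (1 + x) * ((1 - x) ^ (-1 + 2 * ε) * (1 - x)) := by ring
    _ ≤ 12 / 1 ^ 2 * 2 := by rw [e]; gcongr
    _ = 24 := by norm_num

lemma abs_mul_le_mul {a b A B : ℝ} (ha : |a| ≤ A) (hb : |b| ≤ B) : |a * b| ≤ A * B := by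
  rw [abs_mul]
  exact mul_le_mul ha hb (abs_nonneg _) ((abs_nonneg _).trans ha)

/-- the bilinear operator `Q = (Qθ, Qφ)` (as in Statement 5) maps the
log-weighted space `X × X` boundedly into the log-weighted `Y`, with `Qθ → 0` at `±1`
and `Qθ''(0) = 0`. -/
theorem stmt7 (ε : ℝ) (hε : 0 < ε) (hε2 : ε < 1/2) :
    ∃ C > 0,
      ∀ (Ut Ut' Ut'' Ut''' Vt Vt' Vt'' Vt''' Uφ Uφ' Uφ'' Vφ Vφ' Vφ'' : ℝ → ℝ)
        (MU MV : ℝ),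
      (∀ x ∈ Ioo (-1:ℝ) 1, HasDerivAt Ut (Ut' x) x) →
      (∀ x ∈ Ioo (-(1:ℝ)/2) (1/2), HasDerivAt Ut' (Ut'' x) x) →
      (∀ x ∈ Ioo (-(1:ℝ)/2) (1/2), HasDerivAt Ut'' (Ut''' x) x) →
      (∀ x ∈ Ioo (-1:ℝ) 1, HasDerivAt Vt (Vt' x) x) →
      (∀ x ∈ Ioo (-(1:ℝ)/2) (1/2), HasDerivAt Vt' (Vt'' x) x) →
      (∀ x ∈ Ioo (-(1:ℝ)/2) (1/2), HasDerivAt Vt'' (Vt''' x) x) →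
      (∀ x ∈ Ioo (-1:ℝ) 1, HasDerivAt Uφ (Uφ' x) x) →
      (∀ x ∈ Ioo (-1:ℝ) 1, HasDerivAt Uφ' (Uφ'' x) x) →
      (∀ x ∈ Ioo (-1:ℝ) 1, HasDerivAt Vφ (Vφ' x) x) →
      (∀ x ∈ Ioo (-1:ℝ) 1, HasDerivAt Vφ' (Vφ'' x) x) →
      -- finite log-weighted M₁-norms bounded by MU, MV
      (∀ x ∈ Ioo (-1:ℝ) 1,
        |Real.log ((1+x)/3)| * (1-x) ^ (-1+2*ε) * |Ut x| ≤ MU ∧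
        (1+x) * (Real.log ((1+x)/3))^2 * (1-x) ^ (2*ε) * |Ut' x| ≤ MU) →
      (∀ x ∈ Ioo (-(1:ℝ)/2) (1/2), |Ut'' x| ≤ MU ∧ |Ut''' x| ≤ MU) →
      (∀ x ∈ Ioo (-1:ℝ) 1,
        |Real.log ((1+x)/3)| * (1-x) ^ (-1+2*ε) * |Vt x| ≤ MV ∧
        (1+x) * (Real.log ((1+x)/3))^2 * (1-x) ^ (2*ε) * |Vt' x| ≤ MV) →
      (∀ x ∈ Ioo (-(1:ℝ)/2) (1/2), |Vt'' x| ≤ MV ∧ |Vt''' x| ≤ MV) →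
      -- finite M₂-norms bounded by MU, MV
      (∀ x ∈ Ioo (-1:ℝ) 1,
        (1-x^2) ^ ε * |Uφ x| ≤ MU ∧ (1-x^2) ^ (1+ε) * |Uφ' x| ≤ MU ∧
          (1-x^2) ^ (2+ε) * |Uφ'' x| ≤ MU) →
      (∀ x ∈ Ioo (-1:ℝ) 1,
        (1-x^2) ^ ε * |Vφ x| ≤ MV ∧ (1-x^2) ^ (1+ε) * |Vφ' x| ≤ MV ∧
          (1-x^2) ^ (2+ε) * |Vφ'' x| ≤ MV) →
      (let ψ : ℝ → ℝ := fun x =>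
        ∫ l in (0:ℝ)..x, ∫ t in (0:ℝ)..l, ∫ s in (0:ℝ)..t, 2 * Uφ s * Vφ' s / (1-s^2)
       ∃ Ψ : ℝ → ℝ, ContinuousOn Ψ (Icc (-1:ℝ) 1) ∧
        (∀ x ∈ Ioo (-1:ℝ) 1, Ψ x = ψ x) ∧
        (let Qθ : ℝ → ℝ := fun x =>
          Ut x * Vt x / 2 + ψ x - Ψ (-1) * (1-x) / 2 - Ψ 1 * (1+x) / 2
            + deriv (deriv (fun y => Ut y * Vt y)) 0 * (1-x^2) / 4
         let Qφ : ℝ → ℝ := fun x => Ut x * Vφ' x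
         Tendsto Qθ (nhdsWithin (-1:ℝ) (Ioo (-1:ℝ) 1)) (nhds 0) ∧
         Tendsto Qθ (nhdsWithin (1:ℝ) (Ioo (-1:ℝ) 1)) (nhds 0) ∧
         deriv (deriv Qθ) 0 = 0 ∧
         (∀ x ∈ Ioo (-1:ℝ) 1,
           (Real.log ((1+x)/3))^2 * (1-x) ^ (-1+2*ε) * |Qθ x| ≤ C * MU * MV) ∧
         (∀ x ∈ Ioo (-(1:ℝ)/2) (1/2),
           |deriv Qθ x| ≤ C * MU * MV ∧ |deriv (deriv Qθ) x| ≤ C * MU * MV) ∧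
         (∀ x ∈ Ioo (-1:ℝ) 1, (1-x^2) ^ (1+ε) * |Qφ x| ≤ C * MU * MV))) := by
  have hδ : 0 < 1 - 2 * ε := by linarith
  refine ⟨20000 + 40 / (ε * (1 - 2 * ε) ^ 3), by positivity, ?_⟩
  intro Ut Ut' Ut'' Ut''' Vt Vt' Vt'' Vt''' Uφ Uφ' Uφ'' Vφ Vφ' Vφ'' MU MV
    hU1 hU2 _ hV1 hV2 _ hUφ1 _ _ hVφ2 hMU1 hMU2 hMV1 hMV2 hMUφ hMVφ ψ
  have hMU : 0 ≤ MU := le_trans (abs_nonneg _) (hMU2 0 (by norm_num)).1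
  have hMV : 0 ≤ MV := le_trans (abs_nonneg _) (hMV2 0 (by norm_num)).1
  have hMM : 0 ≤ MU * MV := mul_nonneg hMU hMV
  have hI : Ioo (-(1 : ℝ) / 2) (1 / 2) ⊆ Ioo (-1) 1 := Ioo_subset_Ioo (by norm_num) (by norm_num)
  set f : ℝ → ℝ := fun s => 2 * Uφ s * Vφ' s / (1 - s ^ 2)
  set G : ℝ → ℝ := fun t => ∫ s in (0 : ℝ)..t, f s with hG
  set g : ℝ → ℝ := fun l => ∫ t in (0 : ℝ)..l, G t
  have hfc : ContinuousOn f (Ioo (-1) 1) := by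
    have h1 : ContinuousOn Uφ (Ioo (-1) 1) :=
      fun x hx => (hUφ1 x hx).continuousAt.continuousWithinAt
    have h2 : ContinuousOn Vφ' (Ioo (-1) 1) :=
      fun x hx => (hVφ2 x hx).continuousAt.continuousWithinAt
    exact ((continuousOn_const.mul h1).mul h2).div (by fun_prop)
      fun x hx => by nlinarith [hx.1, hx.2]
  have hGd : ∀ x ∈ Ioo (-1 : ℝ) 1, HasDerivAt G (f x) x :=
    fun x hx => hasDerivAt_integral_of_continuousOn_Ioo hfc hx
  have hGc : ContinuousOn G (Ioo (-1) 1) := fun x hx => (hGd x hx).continuousAt.continuousWithinAt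
  have hgd : ∀ x ∈ Ioo (-1 : ℝ) 1, HasDerivAt g (G x) x :=
    fun x hx => hasDerivAt_integral_of_continuousOn_Ioo hGc hx
  have hgc : ContinuousOn g (Ioo (-1) 1) := fun x hx => (hgd x hx).continuousAt.continuousWithinAt
  have hψd : ∀ x ∈ Ioo (-1 : ℝ) 1, HasDerivAt ψ (g x) x :=
    fun x hx => hasDerivAt_integral_of_continuousOn_Ioo hgc hx
  have hfb : ∀ s ∈ Ioo (-1 : ℝ) 1, |f s| ≤ 2 * (MU * MV) * (1 - |s|) ^ (-(1 + 2 * ε) - 1) :=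
    fun s hs => abs_integrand_le hε hs hMU (hMUφ s hs).1 (hMVφ s hs).2.1
  have hGb : ∀ s ∈ Ioo (-1 : ℝ) 1, |G s| ≤ 2 * (MU * MV) * (1 - |s|) ^ (-(2 * ε) - 1) := by
    intro s hs
    refine (abs_integral_le_rpow (by linarith) (by positivity) hfb hs).trans ?_
    have e : -(1 + 2 * ε) = -(2 * ε) - 1 := by ring
    rw [e]
    have hs1 : 0 ≤ 1 - |s| := by linarith [abs_lt.2 hs]
    have := div_le_self (by positivity : 0 ≤ 2 * (MU * MV)) (by linarith : 1 ≤ 1 + 2 * ε)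
    gcongr
  have hgb : ∀ s ∈ Ioo (-1 : ℝ) 1, |g s| ≤ MU * MV / ε * (1 - |s|) ^ ((1 - 2 * ε) - 1) := by
    intro s hs
    refine (abs_integral_le_rpow (by linarith) (by positivity) hGb hs).trans (le_of_eq ?_)
    rw [mul_div_mul_left _ _ two_ne_zero]
    ring_nf
  have hgi := intervalIntegrable_of_abs_le_rpow hδ hgc hgb
  have hψc : ContinuousOn ψ (Icc (-1) 1) := by
    have := intervalIntegral.continuousOn_primitive_interval' (μ := MeasureTheory.volume)
      (a := 0) hgi (by rw [uIcc_of_le (by norm_num)]; norm_num)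
    rwa [uIcc_of_le (by norm_num)] at this
  refine ⟨ψ, hψc, fun _ _ => rfl, ?_⟩
  intro Qθ Qφ
  have hUb : ∀ x ∈ Ioo (-1 : ℝ) 1, |Ut x| ≤ 6 * MU :=
    fun x hx => abs_le_of_log_weight hε hε2 hMU hx (hMU1 x hx).1
  have hVb : ∀ x ∈ Ioo (-1 : ℝ) 1, |Vt x| ≤ 6 * MV :=
    fun x hx => abs_le_of_log_weight hε hε2 hMV hx (hMV1 x hx).1
  have hU'b : ∀ x ∈ Ioo (-(1 : ℝ) / 2) (1 / 2), |Ut' x| ≤ 36 * MU :=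
    fun x hx => abs_le_of_log_sq_weight hε hε2 hx (hMU1 x (hI hx)).2
  have hV'b : ∀ x ∈ Ioo (-(1 : ℝ) / 2) (1 / 2), |Vt' x| ≤ 36 * MV :=
    fun x hx => abs_le_of_log_sq_weight hε hε2 hx (hMV1 x (hI hx)).2
  set P' : ℝ → ℝ := fun x => Ut' x * Vt x + Ut x * Vt' x
  set P'' : ℝ → ℝ := fun x =>
    (Ut'' x * Vt x + Ut' x * Vt' x) + (Ut' x * Vt' x + Ut x * Vt'' x)
  have hP1 : ∀ x ∈ Ioo (-(1 : ℝ) / 2) (1 / 2), HasDerivAt (fun y => Ut y * Vt y) (P' x) x :=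
    fun x hx => (hU1 x (hI hx)).mul (hV1 x (hI hx))
  have hP2 : ∀ x ∈ Ioo (-(1 : ℝ) / 2) (1 / 2), HasDerivAt P' (P'' x) x :=
    fun x hx => ((hU2 x hx).mul (hV1 x (hI hx))).add ((hU1 x (hI hx)).mul (hV2 x hx))
  have h0 : (0 : ℝ) ∈ Ioo (-(1 : ℝ) / 2) (1 / 2) := by norm_num
  have hd : deriv (deriv fun y => Ut y * Vt y) 0 = P'' 0 :=
    deriv_deriv_of_hasDerivAt isOpen_Ioo hP1 hP2 h0
  have hP'b : ∀ x ∈ Ioo (-(1 : ℝ) / 2) (1 / 2), |P' x| ≤ 432 * (MU * MV) := by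
    intro x hx
    refine (abs_add_le _ _).trans ?_
    linarith [abs_mul_le_mul (hU'b x hx) (hVb x (hI hx)),
      abs_mul_le_mul (hUb x (hI hx)) (hV'b x hx)]
  have hP''b : ∀ x ∈ Ioo (-(1 : ℝ) / 2) (1 / 2), |P'' x| ≤ 2604 * (MU * MV) := by
    intro x hx
    refine (abs_add_le _ _).trans ?_
    linarith [abs_add_le (Ut'' x * Vt x) (Ut' x * Vt' x),
      abs_add_le (Ut' x * Vt' x) (Ut x * Vt'' x),
      abs_mul_le_mul (hMU2 x hx).1 (hVb x (hI hx)), abs_mul_le_mul (hU'b x hx) (hV'b x hx),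
      abs_mul_le_mul (hUb x (hI hx)) (hMV2 x hx).1]
  have hQ : Qθ = fun x => Ut x * Vt x / 2 + ψ x - ψ (-1) * (1 - x) / 2 - ψ 1 * (1 + x) / 2
      + P'' 0 * (1 - x ^ 2) / 4 := by rw [← hd]
  set Q' : ℝ → ℝ := fun x => P' x / 2 + g x + ψ (-1) / 2 - ψ 1 / 2 - P'' 0 * x / 2 with hQ'
  set Q'' : ℝ → ℝ := fun x => P'' x / 2 + G x - P'' 0 / 2 with hQ''
  have hQ1 : ∀ x ∈ Ioo (-(1 : ℝ) / 2) (1 / 2), HasDerivAt Qθ (Q' x) x := by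
    intro x hx
    rw [hQ]
    have hid := hasDerivAt_id' x
    refine ((((((hP1 x hx).div_const 2).add (hψd x (hI hx))).sub
      (((hid.const_sub 1).const_mul (ψ (-1))).div_const 2)).sub
      (((hid.const_add 1).const_mul (ψ 1)).div_const 2)).add
      ((((hid.pow 2).const_sub 1).const_mul (P'' 0)).div_const 4)).congr_deriv ?_
    simp only [hQ']
    push_cast
    ring
  have hQ2 : ∀ x ∈ Ioo (-(1 : ℝ) / 2) (1 / 2), HasDerivAt Q' (Q'' x) x := by
    intro x hx
    refine ((((((hP2 x hx).div_const 2).add (hgd x (hI hx))).add_const (ψ (-1) / 2)).sub_const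
      (ψ 1 / 2)).sub (((hasDerivAt_id' x).const_mul (P'' 0)).div_const 2)).congr_deriv ?_
    simp only [hQ'', mul_one]
  have hQdd : ∀ x ∈ Ioo (-(1 : ℝ) / 2) (1 / 2), deriv (deriv Qθ) x = Q'' x :=
    fun x hx => deriv_deriv_of_hasDerivAt isOpen_Ioo hQ1 hQ2 hx
  set κ := 1 / (ε * (1 - 2 * ε) ^ 3) with hκ
  have hκ0 : 0 ≤ κ * (MU * MV) := by positivity
  have hC : ∀ c ≤ 20000 * (MU * MV) + 40 * (κ * (MU * MV)),
      c ≤ (20000 + 40 / (ε * (1 - 2 * ε) ^ 3)) * MU * MV := by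
    intro c hc
    refine hc.trans (le_of_eq ?_)
    rw [hκ]; ring
  have hN : ∀ x ∈ Ioo (-1 : ℝ) 1,
      (Real.log ((1 + x) / 3)) ^ 2 * (1 - x) ^ (-1 + 2 * ε) * |Qθ x| ≤
        (20000 + 40 / (ε * (1 - 2 * ε) ^ 3)) * MU * MV := by
    intro x hx
    refine hC _ ?_
    have h1x : 0 < 1 - x := by linarith [hx.2]
    have h1 := log_sq_mul_abs_mul_le hε hε2 hMU hx (hMU1 x hx).1 (hMV1 x hx).1
    have h2 := log_sq_mul_abs_sub_interpolation_le (by positivity) hδ (by linarith) hgc hgb hx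
    have h3 := log_sq_mul_one_sub_sq_le hε hε2 hx
    rw [show -(1 - 2 * ε) = -1 + 2 * ε by ring,
      show 36 * (MU * MV / ε) / (1 - 2 * ε) ^ 3 = 36 * (κ * (MU * MV)) by
        rw [hκ]; field_simp] at h2
    set W := Real.log ((1 + x) / 3) ^ 2 * (1 - x) ^ (-1 + 2 * ε)
    have hW0 : 0 ≤ W := by positivity
    have hx2 : 0 < 1 - x ^ 2 := by nlinarith [hx.1, hx.2]
    have h4 : W * (|P'' 0| * (1 - x ^ 2)) ≤ 24 * (2604 * (MU * MV)) :=
      calc _ = W * (1 - x ^ 2) * |P'' 0| := by ring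
        _ ≤ _ := mul_le_mul h3 (hP''b 0 h0) (abs_nonneg _) (by norm_num)
    have e : |Qθ x| ≤ |Ut x * Vt x| / 2 + |ψ x - ψ (-1) * (1 - x) / 2 - ψ 1 * (1 + x) / 2|
        + |P'' 0| * (1 - x ^ 2) / 4 := by
      have e1 : Qθ x = Ut x * Vt x / 2 + (ψ x - ψ (-1) * (1 - x) / 2 - ψ 1 * (1 + x) / 2)
        + P'' 0 * (1 - x ^ 2) / 4 := by rw [hQ]; ring
      rw [e1]
      refine (abs_add_three _ _ _).trans (le_of_eq ?_)
      rw [abs_div, abs_two, abs_div, abs_mul (P'' 0), abs_of_pos hx2,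
        abs_of_pos (by norm_num : (0 : ℝ) < 4)]
    have h5 := mul_le_mul_of_nonneg_left e hW0
    linarith
  refine ⟨?_, ?_, ?_, hN, ?_, ?_⟩
  · refine tendsto_neg_one_of_log_weight
      (K := (20000 + 40 / (ε * (1 - 2 * ε) ^ 3)) * MU * MV) hδ.le (by linarith) fun x hx => ?_
    rw [show -(1 - 2 * ε) = -1 + 2 * ε by ring]
    exact hN x hx
  · refine tendsto_one_of_log_weight
      (K := (20000 + 40 / (ε * (1 - 2 * ε) ^ 3)) * MU * MV) hδ fun x hx => ?_
    rw [show -(1 - 2 * ε) = -1 + 2 * ε by ring]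
    exact hN x hx
  · rw [hQdd 0 h0]
    simp [hQ'', hG]
  · intro x hx
    have hx1 : 1 / 2 ≤ 1 - |x| := by
      have : |x| < 1 / 2 := abs_lt.2 ⟨by linarith [hx.1], hx.2⟩
      linarith
    have hεκ : MU * MV / ε ≤ κ * (MU * MV) ∧ MU * MV / ε / (1 - 2 * ε) ≤ κ * (MU * MV) := by
      have hl : 1 - 2 * ε ≤ 1 := by linarith
      have h3 : (1 - 2 * ε) ^ 3 ≤ 1 - 2 * ε := pow_le_of_le_one hδ.le hl three_ne_zero
      constructor
      · rw [hκ, div_eq_mul_one_div, mul_comm]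
        gcongr
        nlinarith
      · rw [hκ, div_div, div_eq_mul_one_div, mul_comm]
        gcongr
    have hp := abs_integral_one_sub_integral_le hδ hgc hgb le_rfl zero_le_one
    have hm := abs_integral_neg_one_sub_integral_le hδ hgc hgb le_rfl (by norm_num)
    simp only [intervalIntegral.integral_same, sub_zero, add_zero, Real.one_rpow, mul_one] at hp hm
    change |ψ 1| ≤ _ at hp
    change |ψ (-1)| ≤ _ at hm
    have hgx : |g x| ≤ 2 * (κ * (MU * MV)) := by
      have h1 := rpow_neg_le_of_half_le hx1 (by linarith : 0 ≤ 2 * ε)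
      have h2 := rpow_le_two (y := 2) (δ := 2 * ε) (by norm_num) le_rfl (by linarith)
        (by linarith)
      have h3 := hgb x (hI hx)
      rw [show (1 - 2 * ε) - 1 = -(2 * ε) by ring] at h3
      refine h3.trans ?_
      rw [mul_comm]
      exact mul_le_mul (h1.trans h2) hεκ.1 (by positivity) (by norm_num)
    have hGx : |G x| ≤ 8 * (MU * MV) := by
      have h1 := rpow_neg_le_of_half_le hx1 (by linarith : 0 ≤ 1 + 2 * ε)
      have h2 : (2 : ℝ) ^ (1 + 2 * ε) ≤ 4 := by
        rw [Real.rpow_add two_pos, Real.rpow_one]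
        linarith [rpow_le_two (y := 2) (δ := 2 * ε) (by norm_num) le_rfl (by linarith)
          (by linarith)]
      have h3 := hGb x (hI hx)
      rw [show -(2 * ε) - 1 = -(1 + 2 * ε) by ring] at h3
      have h4 := mul_le_mul_of_nonneg_left (h1.trans h2) (by positivity : 0 ≤ 2 * (MU * MV))
      linarith
    constructor
    · rw [(hQ1 x hx).deriv]
      refine hC _ ?_
      have hPx : |P'' 0 * x| ≤ 2604 * (MU * MV) * 1 :=
        abs_mul_le_mul (hP''b 0 h0) (by linarith)
      have h1 := abs_le.1 (hP'b x hx)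
      have h2 := abs_le.1 hgx
      have h3 := abs_le.1 (hp.trans hεκ.2)
      have h4 := abs_le.1 (hm.trans hεκ.2)
      have h5 := abs_le.1 hPx
      simp only [hQ']
      exact abs_le.2 ⟨by linarith, by linarith⟩
    · rw [hQdd x hx]
      refine hC _ ?_
      have hP0 := abs_le.1 (hP''b 0 h0)
      have h1 := abs_le.1 (hP''b x hx)
      have h2 := abs_le.1 hGx
      simp only [hQ'']
      exact abs_le.2 ⟨by linarith, by linarith⟩
  · intro x hx
    refine hC _ ?_
    have hx2 : 0 < 1 - x ^ 2 := by nlinarith [hx.1, hx.2]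
    have h1 := mul_le_mul (hUb x hx) (hMVφ x hx).2.1 (by positivity) (by positivity)
    have e : (1 - x ^ 2) ^ (1 + ε) * |Qφ x| = |Ut x| * ((1 - x ^ 2) ^ (1 + ε) * |Vφ' x|) := by
      simp only [Qφ, abs_mul]; ring
    rw [e]
    linarith
end
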